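/- For every p ∈ {0} ∪ [1,∞), the set L^SIT_p(λ^N) of p-integrable strictly triangular increasing maps equals {Q^μ : μ ∈ P_p(ℝ^N), μ triangular regular}; that is, a measure μ ∈ P_p(ℝ^N) is triangular regular if and only if Q^μ ∈ L^SIT_p(λ^N), and every strictly triangular increasing p-integrable map Q equals Q^μ for μ = Q_# λ^N. Consequently, restricted to L^SIT_p(λ^N), the map Q ↦ Q_# λ^N is the inverse of the isometric embedding μ ↦ Q^μ. -/

import Mathlib

open MeasureTheory ProbabilityTheory Filter Set
open scoped ENNReal NNReal Topology

/-- Lebesgue measure on `(0,1)`. -/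
noncomputable def lambda01 : Measure ℝ := volume.restrict (Set.Ioo (0:ℝ) 1)

/-- The `N`-fold product of Lebesgue measure on `(0,1)`. -/
noncomputable def lambdaN (N : ℕ) : Measure (Fin N → ℝ) :=
  Measure.pi fun _ => lambda01

/-- The open unit cube `(0,1)^N`. -/
def cube (N : ℕ) : Set (Fin N → ℝ) := {u | ∀ i, u i ∈ Set.Ioo (0:ℝ) 1}

/-- A map is triangular (adapted) if its `k`-th component depends only on the first `k`
coordinates. -/
def Triangular {N : ℕ} (Q : (Fin N → ℝ) → Fin N → ℝ) : Prop :=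
  ∀ (k : Fin N) (u v : Fin N → ℝ), (∀ j ≤ k, u j = v j) → Q u k = Q v k

/-- Monotonicity condition (inc) on a set `s`: the `k`-th component is increasing in the
`k`-th coordinate (the earlier coordinates being fixed). -/
def IncOn {N : ℕ} (Q : (Fin N → ℝ) → Fin N → ℝ) (s : Set (Fin N → ℝ)) : Prop :=
  ∀ k : Fin N, ∀ u ∈ s, ∀ v ∈ s, (∀ j < k, u j = v j) → u k ≤ v k → Q u k ≤ Q v k

/-- Strict monotonicity condition (sinc) on a set `s`. -/
def StrictIncOn {N : ℕ} (Q : (Fin N → ℝ) → Fin N → ℝ) (s : Set (Fin N → ℝ)) : Prop :=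
  ∀ k : Fin N, ∀ u ∈ s, ∀ v ∈ s, (∀ j < k, u j = v j) → u k < v k → Q u k < Q v k

/-- Consistency condition (con) on a set `s`: if changing only the `k`-th coordinate does not
change the `k`-th component, then it does not change any later component `m ≥ k`. -/
def ConOn {N : ℕ} (Q : (Fin N → ℝ) → Fin N → ℝ) (s : Set (Fin N → ℝ)) : Prop :=
  ∀ k m : Fin N, k ≤ m → ∀ u ∈ s, ∀ v ∈ s, (∀ j ≠ k, u j = v j) →
    Q u k = Q v k → Q u m = Q v m

/-- A quantile process: a Borel triangular map satisfying (inc) and (con) on the unit cube. -/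
structure IsQuantileProcess {N : ℕ} (Q : (Fin N → ℝ) → Fin N → ℝ) : Prop where
  measurable : Measurable Q
  triangular : Triangular Q
  inc : IncOn Q (cube N)
  con : ConOn Q (cube N)

/-- The (a.e. unique) quantile process of `μ`, chosen via Hilbert's epsilon operator. -/
noncomputable def quantileProcess {N : ℕ} (μ : Measure (Fin N → ℝ)) :
    (Fin N → ℝ) → Fin N → ℝ :=
  Classical.epsilon fun Q => IsQuantileProcess Q ∧ (lambdaN N).map Q = μ

/-- The cost `|x - y|_p^p = ∑ₖ |xₖ - yₖ|^p`, valued in `ℝ≥0∞`. -/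
noncomputable def pCost (p : ℝ) {N : ℕ} (x y : Fin N → ℝ) : ℝ≥0∞ :=
  ∑ k, ENNReal.ofReal (|x k - y k| ^ p)

/-- The bounded cost `|x - y| ∧ 1` used for `p = 0`. -/
noncomputable def cost0 {N : ℕ} (x y : Fin N → ℝ) : ℝ≥0∞ :=
  ENNReal.ofReal (min ‖x - y‖ 1)

/-- The `L_p(λ^N; ℝ^N)`-distance of two maps `(0,1)^N → ℝ^N`
(for `p = 0` the distance `∫ |f - g| ∧ 1 dλ^N` of convergence in probability). -/
noncomputable def Ldist (p : ℝ) {N : ℕ} (f g : (Fin N → ℝ) → Fin N → ℝ) : ℝ≥0∞ :=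
  if p = 0 then ∫⁻ u, cost0 (f u) (g u) ∂(lambdaN N)
  else (∫⁻ u, pCost p (f u) (g u) ∂(lambdaN N)) ^ p⁻¹

/-- `μ ∈ P_p(ℝ^N)`: a Borel probability measure with finite `p`-th moments
(no moment condition when `p = 0`). -/
def MemPp (p : ℝ) {N : ℕ} (μ : Measure (Fin N → ℝ)) : Prop :=
  IsProbabilityMeasure μ ∧
    (p = 0 ∨ ∫⁻ x, ∑ k, ENNReal.ofReal (|x k| ^ p) ∂μ < ⊤)

/-- `T` is `p`-integrable w.r.t. `λ^N` (no condition when `p = 0`). -/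
def FinLp (p : ℝ) {N : ℕ} (T : (Fin N → ℝ) → Fin N → ℝ) : Prop :=
  p = 0 ∨ ∫⁻ u, ∑ k, ENNReal.ofReal (|T u k| ^ p) ∂(lambdaN N) < ⊤

/-- The Knothe–Rosenblatt distance `KR_p(μ,ν)` (for `p = 0` the metric
`∫ |Q^μ - Q^ν| ∧ 1 dλ^N`). -/
noncomputable def KRdist (p : ℝ) {N : ℕ} (μ ν : Measure (Fin N → ℝ)) : ℝ≥0∞ :=
  Ldist p (quantileProcess μ) (quantileProcess ν)

/-- An increasing triangular transformation: a Borel triangular map satisfying (inc) on a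
`λ^N`-full subset of the unit cube. -/
def IncreasingTriangular {N : ℕ} (T : (Fin N → ℝ) → Fin N → ℝ) : Prop :=
  Measurable T ∧ Triangular T ∧
    ∃ Γ : Set (Fin N → ℝ), Γ ⊆ cube N ∧ lambdaN N Γᶜ = 0 ∧ IncOn T Γ

/-- A strictly increasing triangular transformation: a Borel triangular map satisfying (sinc)
on a `λ^N`-full subset of the unit cube. -/
def StrictlyIncreasingTriangular {N : ℕ} (T : (Fin N → ℝ) → Fin N → ℝ) : Prop :=
  Measurable T ∧ Triangular T ∧
    ∃ Γ : Set (Fin N → ℝ), Γ ⊆ cube N ∧ lambdaN N Γᶜ = 0 ∧ StrictIncOn T Γ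

/-- `κ` is a disintegration (regular conditional law) of `ρ` w.r.t. its first coordinate. -/
def Disintegrates {α β : Type*} [MeasurableSpace α] [MeasurableSpace β]
    (ρ : Measure (α × β)) (κ : Kernel α β) : Prop :=
  ∀ (A : Set α) (B : Set β), MeasurableSet A → MeasurableSet B →
    ρ (A ×ˢ B) = ∫⁻ a in A, κ a B ∂(ρ.map Prod.fst)

/-- The first `k` coordinates of `x : ℝ^N`. -/
def restr {N : ℕ} (k : Fin N) (x : Fin N → ℝ) : Fin (k : ℕ) → ℝ :=
  fun j => x ⟨j, j.isLt.trans k.isLt⟩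

/-- `μ` is triangular regular: for every `k` the conditional law of `x_k` given
`x_{1:k-1}` under `μ` is a.s. atomless. -/
def TriangularRegular {N : ℕ} (μ : Measure (Fin N → ℝ)) : Prop :=
  ∀ k : Fin N, ∃ κ : Kernel (Fin (k : ℕ) → ℝ) ℝ, IsMarkovKernel κ ∧
    Disintegrates (μ.map fun x => (restr k x, x k)) κ ∧
    ∀ᵐ a ∂(μ.map (restr k)), ∀ x : ℝ, (κ a) {x} = 0

instance isProbabilityMeasure_lambda01 : IsProbabilityMeasure lambda01 :=
  ⟨by simp [lambda01]⟩

instance nullSingletonClass_lambda01 : NullSingletonClass lambda01 := by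
  unfold lambda01; infer_instance

instance isProbabilityMeasure_lambdaN (N : ℕ) : IsProbabilityMeasure (lambdaN N) := by
  unfold lambdaN; infer_instance

theorem ae_mem_cube (N : ℕ) : ∀ᵐ u ∂lambdaN N, u ∈ cube N := by
  refine ae_all_iff.2 fun i => ?_
  have h : ∀ᵐ t ∂lambda01, t ∈ Ioo (0 : ℝ) 1 := ae_restrict_mem measurableSet_Ioo
  exact (measurePreserving_eval (fun _ : Fin N => lambda01) i).quasiMeasurePreserving.ae h

theorem lambdaN_hyperplane {N : ℕ} (k : Fin N) (c : ℝ) : lambdaN N {w | w k = c} = 0 :=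
  Measure.pi_hyperplane (fun _ : Fin N => lambda01) k c

theorem measurable_restr {N : ℕ} (k : Fin N) : Measurable (restr k) :=
  measurable_pi_lambda _ fun _ => measurable_pi_apply _

/-- Replacing some coordinates by those of an independent copy preserves `λ^N`. -/
theorem measurePreserving_ite {N : ℕ} (P : Fin N → Prop) [DecidablePred P] :
    MeasurePreserving (fun z : (Fin N → ℝ) × (Fin N → ℝ) => fun i => if P i then z.2 i else z.1 i)
      ((lambdaN N).prod (lambdaN N)) (lambdaN N) := by
  have hm : Measurable (fun z : (Fin N → ℝ) × (Fin N → ℝ) =>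
      fun i => if P i then z.2 i else z.1 i) := by
    refine measurable_pi_lambda _ fun i => ?_
    by_cases h : P i <;> simp only [h, if_true, if_false] <;> fun_prop
  refine ⟨hm, (Measure.pi_eq fun s hs => ?_).symm⟩
  rw [Measure.map_apply hm (MeasurableSet.univ_pi hs)]
  have : (fun z : (Fin N → ℝ) × (Fin N → ℝ) => fun i => if P i then z.2 i else z.1 i) ⁻¹'
      univ.pi s = (univ.pi fun i => if P i then univ else s i) ×ˢ
        (univ.pi fun i => if P i then s i else univ) := by
    ext z
    simp only [mem_preimage, mem_univ_pi, mem_prod, ← forall_and]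
    refine forall_congr' fun i => ?_
    by_cases h : P i <;> simp [h]
  rw [this, Measure.prod_prod, lambdaN, Measure.pi_pi, Measure.pi_pi, ← Finset.prod_mul_distrib]
  refine Finset.prod_congr rfl fun i _ => ?_
  by_cases h : P i <;> simp [h]

/-- Resampling a single coordinate preserves `λ^N`. -/
theorem measurePreserving_update {N : ℕ} (k : Fin N) :
    MeasurePreserving (fun z : (Fin N → ℝ) × (Fin N → ℝ) => Function.update z.1 k (z.2 k))
      ((lambdaN N).prod (lambdaN N)) (lambdaN N) := by
  convert measurePreserving_ite (fun i : Fin N => i = k) using 2 with z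
  ext i
  by_cases h : i = k
  · subst h; simp
  · simp [h]

theorem lambdaN_eq_lintegral_update {N : ℕ} (k : Fin N) {E : Set (Fin N → ℝ)}
    (hE : MeasurableSet E) :
    lambdaN N E = ∫⁻ u, lambdaN N {w | Function.update u k (w k) ∈ E} ∂lambdaN N := by
  have h := measurePreserving_update k
  rw [← h.measure_preimage hE.nullMeasurableSet, Measure.prod_apply (h.measurable hE)]
  rfl

theorem ae_ae_update {N : ℕ} (k : Fin N) {p : (Fin N → ℝ) → Prop}
    (hp : ∀ᵐ u ∂lambdaN N, p u) :
    ∀ᵐ u ∂lambdaN N, ∀ᵐ w ∂lambdaN N, p (Function.update u k (w k)) :=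
  Measure.ae_ae_of_ae_prod ((measurePreserving_update k).quasiMeasurePreserving.ae hp)

theorem ae_of_ae_ae_update {N : ℕ} (k : Fin N) {p : (Fin N → ℝ) → Prop}
    (hm : MeasurableSet {u | p u})
    (h : ∀ᵐ u ∂lambdaN N, ∀ᵐ w ∂lambdaN N, p (Function.update u k (w k))) :
    ∀ᵐ u ∂lambdaN N, p u := by
  rw [ae_iff]
  change lambdaN N {u | p u}ᶜ = 0
  rw [lambdaN_eq_lintegral_update k hm.compl, lintegral_eq_zero_iff']
  · filter_upwards [h] with u hu
    exact hu
  · exact (measurable_measure_prodMk_left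
      ((measurePreserving_update k).measurable hm.compl)).aemeasurable

/-- If the components of `Q` below `k` are injective in their last variable on a full set, then
every function of the first `k` coordinates factors a.e. through the first `k` components. -/
theorem exists_measurable_factor {N : ℕ} {Q : (Fin N → ℝ) → Fin N → ℝ} (hQ : Measurable Q)
    (hT : Triangular Q) (k : Fin N) {G : Set (Fin N → ℝ)} (hG : ∀ᵐ u ∂lambdaN N, u ∈ G)
    (hinj : ∀ j < k, ∀ u ∈ G, ∀ v ∈ G, (∀ i < j, u i = v i) → u j < v j → Q u j ≠ Q v j)
    {g : (Fin N → ℝ) → ℝ} (hg : Measurable g)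
    (hgk : ∀ u v, (∀ j < k, u j = v j) → g u = g v) :
    ∃ f : (Fin (k : ℕ) → ℝ) → ℝ, Measurable f ∧ ∀ᵐ u ∂lambdaN N, g u = f (restr k (Q u)) := by
  obtain ⟨t, htG, htm, ht0⟩ := exists_measurable_superset_of_null (ae_iff.1 hG)
  have hGt : ∀ u ∈ tᶜ, u ∈ G := fun u hu => by
    by_contra h
    exact hu (htG h)
  have hsb : StandardBorelSpace (tᶜ : Set (Fin N → ℝ)) := htm.compl.standardBorel
  let Φ : (tᶜ : Set (Fin N → ℝ)) → Fin N → ℝ := fun u i => if i < k then Q u i else (u : Fin N → ℝ) i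
  have hΦm : Measurable Φ := by
    refine measurable_pi_lambda _ fun i => ?_
    by_cases h : i < k <;> simp only [Φ, h, if_true, if_false]
    · exact (measurable_pi_apply i).comp (hQ.comp measurable_subtype_coe)
    · exact (measurable_pi_apply i).comp measurable_subtype_coe
  have hΦi : Function.Injective Φ := by
    intro u v huv
    by_contra hne
    have hex : ∃ j, (u : Fin N → ℝ) j ≠ (v : Fin N → ℝ) j := by
      by_contra! h
      exact hne (Subtype.ext (funext h))
    obtain ⟨j, hj, hmin⟩ := WellFounded.has_min (wellFounded_lt (α := Fin N))
      {j | (u : Fin N → ℝ) j ≠ (v : Fin N → ℝ) j} hex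
    have hlow : ∀ i < j, (u : Fin N → ℝ) i = (v : Fin N → ℝ) i := fun i hi => by
      by_contra h
      exact hmin i h hi
    have hΦj := congrFun huv j
    by_cases hjk : j < k
    · simp only [Φ, hjk, if_true] at hΦj
      rcases lt_or_gt_of_ne hj with h | h
      · exact hinj j hjk u (hGt _ u.2) v (hGt _ v.2) hlow h hΦj
      · exact hinj j hjk v (hGt _ v.2) u (hGt _ u.2) (fun i hi => (hlow i hi).symm) h hΦj.symm
    · simp only [Φ, hjk, if_false] at hΦj
      exact hj hΦj
  obtain ⟨F, hF, hFg⟩ := (hΦm.measurableEmbedding hΦi).exists_measurable_extend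
    (hg.comp measurable_subtype_coe) (fun _ => inferInstance)
  have hmix : ∀ᵐ w ∂lambdaN N, ∀ᵐ u ∂lambdaN N, (fun i => if i < k then u i else w i) ∈ tᶜ :=
    Measure.ae_ae_of_ae_prod ((measurePreserving_ite (fun i : Fin N => i < k)).quasiMeasurePreserving.ae
      (measure_eq_zero_iff_ae_notMem.1 ht0))
  obtain ⟨w, hw⟩ := hmix.exists
  refine ⟨fun x => F fun i => if h : (i : ℕ) < k then x ⟨i, h⟩ else w i, ?_, ?_⟩
  · refine hF.comp (measurable_pi_lambda _ fun i => ?_)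
    by_cases h : (i : ℕ) < k <;> simp only [h, dif_pos, dif_neg, not_false_eq_true] <;> fun_prop
  · filter_upwards [hw] with u hu
    have hlow : ∀ j < k, u j = (fun i => if i < k then u i else w i) j := fun j hj => by simp [hj]
    rw [hgk u _ hlow]
    refine (congrFun hFg ⟨_, hu⟩).symm.trans ?_
    simp only [Function.comp, Φ]
    congr 1
    ext i
    by_cases h : i < k
    · have h' : (i : ℕ) < k := h
      simp only [h, if_true, h', dif_pos, restr]
      exact (hT i _ _ fun j hj => hlow j (hj.trans_lt h)).symm
    · have h' : ¬ (i : ℕ) < k := h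
      simp [h, h']

/-- The atoms of a measurable family of probability measures are contained in countably many
measurable graphs. -/
theorem exists_measurable_atoms {α : Type*} [MeasurableSpace α] (κ : Kernel α ℝ)
    [IsMarkovKernel κ] :
    ∃ f : ℚ → α → ℝ, (∀ q, Measurable (f q)) ∧ ∀ a x, κ a {x} ≠ 0 → ∃ q, f q a = x := by
  let f : ℚ → α → EReal := fun q a =>
    ⨅ r : ℚ, if (Real.toNNReal q : ℝ≥0∞) ≤ κ a (Iic (r : ℝ)) then ((r : ℝ) : EReal) else ⊤
  have hf : ∀ q, Measurable (f q) := fun q => by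
    refine Measurable.iInf fun r => Measurable.ite ?_ measurable_const measurable_const
    exact measurableSet_le measurable_const (κ.measurable_coe measurableSet_Iic)
  refine ⟨fun q a => (f q a).toReal, fun q => (hf q).ereal_toReal, fun a x hx => ?_⟩
  have hlt : κ a (Iio x) < κ a (Iic x) := by
    rw [← Iio_union_right, measure_union (by simp) (measurableSet_singleton x)]
    exact ENNReal.lt_add_right (measure_ne_top _ _) hx
  obtain ⟨q, -, hq1, hq2⟩ := ENNReal.lt_iff_exists_rat_btwn.1 hlt
  refine ⟨q, ?_⟩
  have : f q a = (x : EReal) := by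
    refine le_antisymm ?_ (le_iInf fun r => ?_)
    · refine EReal.le_of_forall_lt_iff_le.1 fun z hz => ?_
      obtain ⟨r, hr1, hr2⟩ := exists_rat_btwn (EReal.coe_lt_coe_iff.1 hz)
      refine (iInf_le _ r).trans ?_
      rw [if_pos (hq2.le.trans (measure_mono (Iic_subset_Iic.2 hr1.le)))]
      exact EReal.coe_le_coe_iff.2 hr2.le
    · split_ifs with h
      · rw [EReal.coe_le_coe_iff]
        by_contra! hr
        exact (h.trans (measure_mono (Iic_subset_Iio.2 hr))).not_gt hq1
      · exact le_top
  simp [this]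

/-- Triangular regularity means that measurable graphs over the past are null. -/
theorem triangularRegular_iff {N : ℕ} (μ : Measure (Fin N → ℝ)) [IsProbabilityMeasure μ] :
    TriangularRegular μ ↔ ∀ (k : Fin N) (f : (Fin (k : ℕ) → ℝ) → ℝ), Measurable f →
      ∀ᵐ x ∂μ, x k ≠ f (restr k x) := by
  refine forall_congr' fun k => ?_
  have hm : Measurable fun x : Fin N → ℝ => (restr k x, x k) :=
    (measurable_restr k).prodMk (measurable_pi_apply k)
  have hfst : (μ.map fun x => (restr k x, x k)).map Prod.fst = μ.map (restr k) := by
    rw [Measure.map_map measurable_fst hm]; rfl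
  have hprob : IsProbabilityMeasure (μ.map fun x => (restr k x, x k)) :=
    Measure.isProbabilityMeasure_map hm.aemeasurable
  have hprob' : IsProbabilityMeasure (μ.map (restr k)) :=
    Measure.isProbabilityMeasure_map (measurable_restr k).aemeasurable
  have hgraph : ∀ f : (Fin (k : ℕ) → ℝ) → ℝ, Measurable f →
      MeasurableSet {z : (Fin (k : ℕ) → ℝ) × ℝ | z.2 = f z.1} := fun f hf =>
    measurableSet_eq_fun measurable_snd (hf.comp measurable_fst)
  have key : ∀ (κ : Kernel (Fin (k : ℕ) → ℝ) ℝ) [IsMarkovKernel κ],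
      (μ.map (restr k)) ⊗ₘ κ = (μ.map fun x => (restr k x, x k)) →
      ∀ f : (Fin (k : ℕ) → ℝ) → ℝ, Measurable f →
        ((∀ᵐ x ∂μ, x k ≠ f (restr k x)) ↔ ∀ᵐ a ∂μ.map (restr k), κ a {f a} = 0) := by
    intro κ _ hκ f hf
    have h1 : μ {x | x k = f (restr k x)} = ∫⁻ a, κ a {f a} ∂μ.map (restr k) := by
      have := congrArg (fun ρ => ρ {z : (Fin (k : ℕ) → ℝ) × ℝ | z.2 = f z.1}) hκ
      simp only [Measure.compProd_apply (hgraph f hf), Measure.map_apply hm (hgraph f hf)] at this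
      exact this.symm
    have hmeas : Measurable fun a => κ a {f a} :=
      Kernel.measurable_kernel_prodMk_left (hgraph f hf)
    have h2 : (∀ᵐ x ∂μ, x k ≠ f (restr k x)) ↔ μ {x | x k = f (restr k x)} = 0 := by
      rw [ae_iff]; simp
    rw [h2, h1, lintegral_eq_zero_iff hmeas]
    rfl
  constructor
  · rintro ⟨κ, hκM, hκ, hat⟩ f hf
    refine (key κ ?_ f hf).2 (hat.mono fun a ha => ha _)
    refine Measure.ext_prod fun {s t} hs ht => ?_
    rw [Measure.compProd_apply_prod hs ht, hκ s t hs ht, hfst]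
  · intro h
    let κ := (μ.map fun x => (restr k x, x k)).condKernel
    have hκ : (μ.map (restr k)) ⊗ₘ κ = (μ.map fun x => (restr k x, x k)) := by
      rw [← hfst]
      exact Measure.disintegrate _ _
    refine ⟨κ, inferInstance, fun A B hA hB => ?_, ?_⟩
    · rw [hfst, ← Measure.compProd_apply_prod hA hB, hκ]
    · obtain ⟨f, hf, hatom⟩ := exists_measurable_atoms κ
      have : ∀ᵐ a ∂μ.map (restr k), ∀ q, κ a {f q a} = 0 :=
        ae_all_iff.2 fun q => (key κ hκ _ (hf q)).1 (h _ (hf q))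
      filter_upwards [this] with a ha x
      by_contra hx
      obtain ⟨q, rfl⟩ := hatom a x hx
      exact hx (ha q)

theorem StrictlyIncreasingTriangular.triangularRegular_map {N : ℕ}
    {Q : (Fin N → ℝ) → Fin N → ℝ} (hQ : StrictlyIncreasingTriangular Q) :
    TriangularRegular ((lambdaN N).map Q) := by
  obtain ⟨hm, hT, Γ, -, hΓ0, hΓ⟩ := hQ
  have := Measure.isProbabilityMeasure_map (μ := lambdaN N) hm.aemeasurable
  refine (triangularRegular_iff _).2 fun k f hf => ?_
  have hset : MeasurableSet {x : Fin N → ℝ | x k = f (restr k x)} :=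
    measurableSet_eq_fun (measurable_pi_apply k) (hf.comp (measurable_restr k))
  refine (ae_map_iff hm.aemeasurable hset.compl).2 ?_
  refine ae_of_ae_ae_update k (hm hset.compl) ?_
  filter_upwards [ae_ae_update k (p := (· ∈ Γ)) hΓ0] with u hu
  have hpast : ∀ s t, restr k (Q (Function.update u k s)) = restr k (Q (Function.update u k t)) :=
    fun s t => funext fun j => hT _ _ _ fun i hi => by
      have : i ≠ k := (lt_of_le_of_lt hi j.isLt : i < k).ne
      simp [this]
  have hslice : ∀ s t, Function.update u k s ∈ Γ → Function.update u k t ∈ Γ → s < t →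
      Q (Function.update u k s) k < Q (Function.update u k t) k := fun s t hs ht hst =>
    hΓ k _ hs _ ht (fun j hj => by simp [hj.ne]) (by simpa using hst)
  by_cases hex : ∃ c, Function.update u k c ∈ Γ ∧
      Q (Function.update u k c) k = f (restr k (Q (Function.update u k c)))
  · obtain ⟨c, hc, hcf⟩ := hex
    have hne : ∀ᵐ w ∂lambdaN N, w k ≠ c := by
      rw [ae_iff]; simpa using lambdaN_hyperplane k c
    filter_upwards [hu, hne] with w hw hwc heq
    rw [hpast _ c, ← hcf] at heq
    rcases lt_or_gt_of_ne hwc with h | h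
    · exact (hslice _ _ hw hc h).ne heq
    · exact (hslice _ _ hc hw h).ne heq.symm
  · filter_upwards [hu] with w hw heq
    exact hex ⟨_, hw, heq⟩

/-- An increasing triangular map with triangular regular law is strictly increasing. -/
theorem strictlyIncreasingTriangular_of_triangularRegular {N : ℕ}
    {Q : (Fin N → ℝ) → Fin N → ℝ} (hm : Measurable Q) (hT : Triangular Q)
    (hinc : IncOn Q (cube N)) (hreg : TriangularRegular ((lambdaN N).map Q)) :
    StrictlyIncreasingTriangular Q := by
  let Good : Fin N → (Fin N → ℝ) → Prop := fun k u =>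
    ∀ q : ℚ, (q : ℝ) ∈ Ioo (0 : ℝ) 1 → Q u k ≠ Q (Function.update u k (q : ℝ)) k
  have strict : ∀ k, ∀ u ∈ cube N, Good k u → ∀ v ∈ cube N, (∀ j < k, u j = v j) →
      u k < v k → Q u k < Q v k := by
    intro k u hu hgood v hv huv hlt
    obtain ⟨q, hq1, hq2⟩ := exists_rat_btwn hlt
    have hq : (q : ℝ) ∈ Ioo (0 : ℝ) 1 := ⟨(hu k).1.trans hq1, hq2.trans (hv k).2⟩
    have hw : Function.update u k (q : ℝ) ∈ cube N := fun i => by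
      by_cases h : i = k
      · subst h; simpa using hq
      · simpa [h] using hu i
    have h1 := hinc k u hu _ hw (fun j hj => by simp [hj.ne]) (by simpa using hq1.le)
    have h2 := hinc k _ hw v hv (fun j hj => by simpa [hj.ne] using huv j hj) (by simpa using hq2.le)
    exact (lt_of_le_of_ne h1 (hgood q hq)).trans_le h2
  have := Measure.isProbabilityMeasure_map (μ := lambdaN N) hm.aemeasurable
  have hgraph := (triangularRegular_iff _).1 hreg
  have good : ∀ k, ∀ᵐ u ∂lambdaN N, Good k u := by
    intro k
    induction k using WellFoundedLT.induction with
    | ind k ih =>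
    refine ae_all_iff.2 fun q => ae_all_iff.2 fun _ => ?_
    have hup : Measurable fun u : Fin N → ℝ => Function.update u k (q : ℝ) :=
      measurable_update_left
    obtain ⟨f, hf, hfac⟩ := exists_measurable_factor hm hT k
      (G := {u | u ∈ cube N ∧ ∀ j < k, Good j u})
      ((ae_mem_cube N).and (ae_all_iff.2 fun j => ae_all_iff.2 fun hj => ih j hj))
      (fun j hj u hu v hv huv hlt => (strict j u hu.1 (hu.2 j hj) v hv.1 huv hlt).ne)
      (g := fun u => Q (Function.update u k (q : ℝ)) k)
      ((measurable_pi_apply k).comp (hm.comp hup))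
      (fun u v huv => hT k _ _ fun j hj => by
        rcases hj.lt_or_eq with h | rfl
        · simpa [h.ne] using huv j h
        · simp)
    filter_upwards [hfac, ae_of_ae_map hm.aemeasurable (hgraph k f hf)] with u hu1 hu2
    rwa [hu1]
  refine ⟨hm, hT, {u | u ∈ cube N ∧ ∀ k, Good k u}, fun u hu => hu.1, ?_, ?_⟩
  · exact (ae_mem_cube N).and (ae_all_iff.2 good)
  · exact fun k u hu v hv huv hlt => strict k u hu.1 (hu.2 k) v hv.1 huv hlt

/-- Given the past, the conditional probability that the `k`-th component of `Q` is at most `c`. -/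
noncomputable def sliceMass {N : ℕ} (Q : (Fin N → ℝ) → Fin N → ℝ) (k : Fin N) (c : ℝ)
    (u : Fin N → ℝ) : ℝ≥0∞ :=
  lambdaN N {w | Q (Function.update u k (w k)) k ≤ c}

theorem measurableSet_component_le {N : ℕ} {Q : (Fin N → ℝ) → Fin N → ℝ} (hm : Measurable Q)
    (k : Fin N) (c : ℝ) : MeasurableSet {u | Q u k ≤ c} :=
  measurableSet_le ((measurable_pi_apply k).comp hm) measurable_const

theorem measurable_sliceMass {N : ℕ} {Q : (Fin N → ℝ) → Fin N → ℝ} (hm : Measurable Q)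
    (k : Fin N) (c : ℝ) : Measurable (sliceMass Q k c) :=
  measurable_measure_prodMk_left
    ((measurePreserving_update k).measurable (measurableSet_component_le hm k c))

theorem Triangular.component_update_eq {N : ℕ} {Q : (Fin N → ℝ) → Fin N → ℝ} (hT : Triangular Q)
    {k : Fin N} {u v : Fin N → ℝ} (huv : ∀ j < k, u j = v j) (t : ℝ) :
    Q (Function.update u k t) k = Q (Function.update v k t) k :=
  hT k _ _ fun j hj => by
    rcases hj.lt_or_eq with h | rfl
    · simpa [h.ne] using huv j h
    · simp

theorem Triangular.sliceMass_eq {N : ℕ} {Q : (Fin N → ℝ) → Fin N → ℝ} (hT : Triangular Q)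
    {k : Fin N} (c : ℝ) {u v : Fin N → ℝ} (huv : ∀ j < k, u j = v j) :
    sliceMass Q k c u = sliceMass Q k c v := by
  simp only [sliceMass, hT.component_update_eq huv]

theorem lambdaN_component_le_inter {N : ℕ} {Q : (Fin N → ℝ) → Fin N → ℝ} (hm : Measurable Q)
    (k : Fin N) (c : ℝ) {M : Set (Fin N → ℝ)} (hM : MeasurableSet M)
    (hMk : ∀ u v, (∀ j < k, u j = v j) → (u ∈ M ↔ v ∈ M)) :
    lambdaN N ({u | Q u k ≤ c} ∩ M) = ∫⁻ u in M, sliceMass Q k c u ∂lambdaN N := by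
  rw [lambdaN_eq_lintegral_update k ((measurableSet_component_le hm k c).inter hM),
    ← lintegral_indicator hM]
  congr 1 with u
  have hu : ∀ t, Function.update u k t ∈ M ↔ u ∈ M := fun t =>
    hMk _ _ fun j hj => by simp [hj.ne]
  by_cases h : u ∈ M <;> simp [h, hu, sliceMass]

/-- Two strictly increasing triangular maps with the same law and a.e. the same past have the same
conditional distribution functions. -/
theorem sliceMass_ae_le {N : ℕ} {Q Q' : (Fin N → ℝ) → Fin N → ℝ} (hm : Measurable Q)
    (hm' : Measurable Q') (hT : Triangular Q) (hT' : Triangular Q') {G : Set (Fin N → ℝ)}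
    (hG : ∀ᵐ u ∂lambdaN N, u ∈ G) (hs : StrictIncOn Q G)
    (hlaw : (lambdaN N).map Q = (lambdaN N).map Q') (k : Fin N)
    (hpast : ∀ᵐ u ∂lambdaN N, restr k (Q u) = restr k (Q' u)) (c : ℝ) :
    ∀ᵐ u ∂lambdaN N, sliceMass Q k c u ≤ sliceMass Q' k c u := by
  let M : Set (Fin N → ℝ) := {u | sliceMass Q' k c u < sliceMass Q k c u}
  have hM : MeasurableSet M :=
    measurableSet_lt (measurable_sliceMass hm' k c) (measurable_sliceMass hm k c)
  have hMk : ∀ u v, (∀ j < k, u j = v j) → (u ∈ M ↔ v ∈ M) := fun u v huv => by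
    simp only [M, mem_ofPred_eq, hT.sliceMass_eq c huv, hT'.sliceMass_eq c huv]
  obtain ⟨f, hf, hfac⟩ := exists_measurable_factor hm hT k hG
    (fun j _ u hu v hv huv hlt => (hs j u hu v hv huv hlt).ne)
    (g := M.indicator 1) (measurable_one.indicator hM)
    (fun u v huv => by by_cases h : v ∈ M <;> simp [h, hMk u v huv])
  let B : Set (Fin N → ℝ) := {x | x k ≤ c ∧ f (restr k x) = 1}
  have hB : MeasurableSet B :=
    (measurableSet_le (measurable_pi_apply k) measurable_const).inter
      (measurableSet_eq_fun (hf.comp (measurable_restr k)) measurable_const)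
  have hMf : ∀ᵐ u ∂lambdaN N, (u ∈ M ↔ f (restr k (Q u)) = 1) := by
    filter_upwards [hfac] with u hu
    rw [← hu]
    by_cases h : u ∈ M <;> simp [h]
  have e1 : lambdaN N ({u | Q u k ≤ c} ∩ M) = (lambdaN N).map Q B := by
    rw [Measure.map_apply hm hB]
    refine measure_congr (eventuallyEq_set.2 ?_)
    filter_upwards [hMf] with u hu
    simp [B, hu]
  have e2 : lambdaN N ({u | Q' u k ≤ c} ∩ M) = (lambdaN N).map Q' B := by
    rw [Measure.map_apply hm' hB]
    refine measure_congr (eventuallyEq_set.2 ?_)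
    filter_upwards [hMf, hpast] with u hu hp
    simp [B, hu, hp]
  have hint : ∫⁻ u in M, sliceMass Q k c u ∂lambdaN N = ∫⁻ u in M, sliceMass Q' k c u ∂lambdaN N := by
    rw [← lambdaN_component_le_inter hm k c hM hMk, ← lambdaN_component_le_inter hm' k c hM hMk,
      e1, e2, hlaw]
  have hlt : ∀ᵐ u ∂(lambdaN N).restrict M, sliceMass Q' k c u < sliceMass Q k c u :=
    ae_restrict_mem hM
  have heq := ae_eq_of_ae_le_of_lintegral_le (hlt.mono fun _ h => h.le)
    (by
      rw [← lambdaN_component_le_inter hm' k c hM hMk]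
      exact measure_ne_top _ _)
    (measurable_sliceMass hm k c).aemeasurable hint.le
  have hfalse : ∀ᵐ u ∂(lambdaN N).restrict M, False := by
    filter_upwards [hlt, heq] with u h1 h2
    exact h1.ne h2
  filter_upwards [(ae_restrict_iff' hM).1 hfalse] with u hu
  exact not_lt.1 hu

theorem component_le_iff_of_sliceMass_eq {N : ℕ} {Q Q' : (Fin N → ℝ) → Fin N → ℝ}
    (hm : Measurable Q) (hm' : Measurable Q') {G : Set (Fin N → ℝ)} (hs : StrictIncOn Q G)
    (hs' : StrictIncOn Q' G) (k : Fin N) (c : ℝ) {u : Fin N → ℝ}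
    (hu : ∀ᵐ w ∂lambdaN N, Function.update u k (w k) ∈ G)
    (heq : sliceMass Q k c u = sliceMass Q' k c u) :
    ∀ᵐ w ∂lambdaN N,
      (Q (Function.update u k (w k)) k ≤ c ↔ Q' (Function.update u k (w k)) k ≤ c) := by
  have hup : Measurable fun w : Fin N → ℝ => Function.update u k (w k) :=
    (measurable_update u).comp (measurable_pi_apply k)
  have hA := hup (measurableSet_component_le hm k c)
  have hA' := hup (measurableSet_component_le hm' k c)
  have mono : ∀ {R : (Fin N → ℝ) → Fin N → ℝ}, StrictIncOn R G → ∀ s t,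
      Function.update u k s ∈ G → Function.update u k t ∈ G → s ≤ t →
      R (Function.update u k s) k ≤ R (Function.update u k t) k := by
    intro R hR s t hs ht hst
    rcases hst.lt_or_eq with h | rfl
    · exact (hR k _ hs _ ht (fun j hj => by simp [hj.ne]) (by simpa using h)).le
    · rfl
  by_cases hsub : ∀ w : Fin N → ℝ, Function.update u k (w k) ∈ G →
      Q (Function.update u k (w k)) k ≤ c → Q' (Function.update u k (w k)) k ≤ c
  · exact eventuallyEq_set.1 (ae_eq_of_ae_subset_of_measure_ge (hu.mono hsub) heq.ge
      hA.nullMeasurableSet (measure_ne_top _ _))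
  · push Not at hsub
    obtain ⟨w₀, hw₀, hle, hlt⟩ := hsub
    have hsub' : ∀ w : Fin N → ℝ, Function.update u k (w k) ∈ G →
        Q' (Function.update u k (w k)) k ≤ c → Q (Function.update u k (w k)) k ≤ c := by
      intro w hw hwc
      refine (mono hs _ _ hw hw₀ ?_).trans hle
      by_contra! h
      exact (hlt.trans_le (mono hs' _ _ hw₀ hw h.le)).not_ge hwc
    have := eventuallyEq_set.1 (ae_eq_of_ae_subset_of_measure_ge (hu.mono hsub') heq.le
      hA'.nullMeasurableSet (measure_ne_top _ _))
    exact this.mono fun _ h => h.symm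

/-- A strictly increasing triangular map is determined a.e. by its law. -/
theorem StrictlyIncreasingTriangular.ae_eq_of_map_eq {N : ℕ} {Q Q' : (Fin N → ℝ) → Fin N → ℝ}
    (hQ : StrictlyIncreasingTriangular Q) (hQ' : StrictlyIncreasingTriangular Q')
    (hlaw : (lambdaN N).map Q = (lambdaN N).map Q') : Q =ᵐ[lambdaN N] Q' := by
  obtain ⟨hm, hT, Γ, -, hΓ0, hΓ⟩ := hQ
  obtain ⟨hm', hT', Γ', -, hΓ0', hΓ'⟩ := hQ'
  have hG : ∀ᵐ u ∂lambdaN N, u ∈ Γ ∩ Γ' := Filter.Eventually.and hΓ0 hΓ0'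
  have hs : StrictIncOn Q (Γ ∩ Γ') := fun k u hu v hv => hΓ k u hu.1 v hv.1
  have hs' : StrictIncOn Q' (Γ ∩ Γ') := fun k u hu v hv => hΓ' k u hu.2 v hv.2
  suffices h : ∀ k, ∀ᵐ u ∂lambdaN N, Q u k = Q' u k from (ae_all_iff.2 h).mono fun _ => funext
  intro k
  induction k using WellFoundedLT.induction with
  | ind k ih =>
  have hpast : ∀ᵐ u ∂lambdaN N, restr k (Q u) = restr k (Q' u) := by
    filter_upwards [ae_all_iff.2 fun j => ae_all_iff.2 fun hj => ih j hj] with u hu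
    exact funext fun j => hu _ j.isLt
  have hle : ∀ c : ℚ, ∀ᵐ u ∂lambdaN N, (Q u k ≤ c ↔ Q' u k ≤ c) := by
    intro c
    refine ae_of_ae_ae_update k ?_ ?_
    · exact (measurableSet_component_le hm k c).iff (measurableSet_component_le hm' k c)
    · filter_upwards [sliceMass_ae_le hm hm' hT hT' hG hs hlaw k hpast c,
        sliceMass_ae_le hm' hm hT' hT hG hs' hlaw.symm k (hpast.mono fun _ h => h.symm) c,
        ae_ae_update k hG] with u h1 h2 h3
      exact component_le_iff_of_sliceMass_eq hm hm' hs hs' k c h3 (le_antisymm h1 h2)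
  filter_upwards [ae_all_iff.2 hle] with u hu
  refine le_antisymm ?_ ?_ <;> by_contra! h <;> obtain ⟨q, hq1, hq2⟩ := exists_rat_btwn h
  · exact hq2.not_ge ((hu q).2 hq1.le)
  · exact hq2.not_ge ((hu q).1 hq1.le)

theorem FinLp.memPp_map {N : ℕ} {p : ℝ} {Q : (Fin N → ℝ) → Fin N → ℝ} (h : FinLp p Q)
    (hm : Measurable Q) : MemPp p ((lambdaN N).map Q) := by
  refine ⟨Measure.isProbabilityMeasure_map hm.aemeasurable, h.imp_right fun h => ?_⟩
  rwa [lintegral_map (by fun_prop) hm]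

/-- `L^SIT_p(λ^N) = {Q^μ : μ ∈ P_p(ℝ^N) triangular regular}`:
`μ ∈ P_p(ℝ^N)` is triangular regular iff its quantile process is strictly increasing
triangular, and every `p`-integrable strictly increasing triangular map `Q` is (a.e.) the
quantile process of `μ = Q_# λ^N ∈ P_p(ℝ^N)`; hence `Q ↦ Q_# λ^N` inverts `μ ↦ Q^μ` on
`L^SIT_p(λ^N)`. -/
theorem LSIT_eq_quantileProcesses_of_regular (N : ℕ) (p : ℝ) (hp : p = 0 ∨ 1 ≤ p) :
    (∀ (μ : Measure (Fin N → ℝ)) (Q : (Fin N → ℝ) → Fin N → ℝ),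
      MemPp p μ → IsQuantileProcess Q → (lambdaN N).map Q = μ →
      (TriangularRegular μ ↔
        ∃ S : (Fin N → ℝ) → Fin N → ℝ, StrictlyIncreasingTriangular S ∧ Q =ᵐ[lambdaN N] S)) ∧
    (∀ Q : (Fin N → ℝ) → Fin N → ℝ, StrictlyIncreasingTriangular Q → FinLp p Q →
      MemPp p ((lambdaN N).map Q) ∧ TriangularRegular ((lambdaN N).map Q) ∧
      ∀ Q' : (Fin N → ℝ) → Fin N → ℝ, IsQuantileProcess Q' →
        (lambdaN N).map Q' = (lambdaN N).map Q → Q =ᵐ[lambdaN N] Q') := by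
  refine ⟨?_, fun Q hQ hp => ⟨hp.memPp_map hQ.1, hQ.triangularRegular_map, fun Q' hQ' hlaw => ?_⟩⟩
  · rintro μ Q - hQ rfl
    constructor
    · intro hreg
      exact ⟨Q, strictlyIncreasingTriangular_of_triangularRegular hQ.measurable hQ.triangular
        hQ.inc hreg, ae_eq_refl Q⟩
    · rintro ⟨S, hS, hQS⟩
      rw [Measure.map_congr hQS]
      exact hS.triangularRegular_map
  · refine hQ.ae_eq_of_map_eq (strictlyIncreasingTriangular_of_triangularRegular hQ'.measurable
      hQ'.triangular hQ'.inc ?_) hlaw.symm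
    rw [hlaw]
    exact hQ.triangularRegular_map
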